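/- Let α be a partial action of a finite group G on a C*-algebra A and let I be a G-invariant closed two-sided ideal of A (i.e., α_g(I ∩ A_{g⁻¹}) ⊆ I for all g ∈ G). Let α|_I denote the restricted partial action of G on I (with domains I ∩ A_g) and let ᾱ denote the induced partial action of G on A/I (with domains (A_g + I)/I and maps induced by the α_g). Then dim_Rok(α|_I) ≤ dim_Rok(α) and dim_Rok(ᾱ) ≤ dim_Rok(α); the same estimates hold for dim_Rok^c. -/

import Mathlib

/-- A partial action of a (discrete) group `G` on a C*-algebra `A`: a family of closed
two-sided (star-closed) ideals `dom g ⊆ A` and *-isomorphisms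
`act g : dom g⁻¹ → dom g` (encoded as total maps, with all axioms stated on the domains),
such that `dom 1 = A`, `act 1 = id`, `act g` maps `dom g⁻¹ ∩ dom h` into `dom g ∩ dom (g*h)`,
and `act (g*h)` extends `act g ∘ act h`. -/
structure CStarPartialAction (G : Type*) [Group G] (A : Type*) [NonUnitalCStarAlgebra A] where
  dom : G → Set A
  act : G → A → A
  dom_isClosed : ∀ g, IsClosed (dom g)
  zero_mem : ∀ g, (0 : A) ∈ dom g
  add_mem : ∀ g, ∀ x ∈ dom g, ∀ y ∈ dom g, x + y ∈ dom g
  smul_mem : ∀ g (c : ℂ), ∀ x ∈ dom g, c • x ∈ dom g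
  mul_mem_left : ∀ g (a : A), ∀ x ∈ dom g, a * x ∈ dom g
  mul_mem_right : ∀ g (a : A), ∀ x ∈ dom g, x * a ∈ dom g
  star_mem : ∀ g, ∀ x ∈ dom g, star x ∈ dom g
  dom_one : dom 1 = Set.univ
  act_one : ∀ x, act 1 x = x
  act_mem : ∀ g, ∀ x ∈ dom g⁻¹, act g x ∈ dom g
  act_add : ∀ g, ∀ x ∈ dom g⁻¹, ∀ y ∈ dom g⁻¹, act g (x + y) = act g x + act g y
  act_smul : ∀ g (c : ℂ), ∀ x ∈ dom g⁻¹, act g (c • x) = c • act g x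
  act_mul : ∀ g, ∀ x ∈ dom g⁻¹, ∀ y ∈ dom g⁻¹, act g (x * y) = act g x * act g y
  act_star : ∀ g, ∀ x ∈ dom g⁻¹, act g (star x) = star (act g x)
  act_inv_act : ∀ g, ∀ x ∈ dom g⁻¹, act g⁻¹ (act g x) = x
  act_surjOn : ∀ g, ∀ y ∈ dom g, ∃ x ∈ dom g⁻¹, act g x = y
  act_inter_mem : ∀ g h, ∀ x ∈ dom g⁻¹ ∩ dom h, act g x ∈ dom g ∩ dom (g * h)
  act_comp : ∀ g h, ∀ x ∈ dom h⁻¹ ∩ dom (g * h)⁻¹, act (g * h) x = act g (act h x)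

/-- A positive contraction in a C*-algebra. -/
def IsPosContraction {A : Type*} [NonUnitalCStarAlgebra A] (f : A) : Prop :=
  (∃ b, f = star b * b) ∧ ‖f‖ ≤ 1

variable {G : Type*} [Group G] [Fintype G] {A : Type*} [NonUnitalCStarAlgebra A]

/-- Conditions (1)–(4) of the definition of Rokhlin dimension, for the tolerance `ε` and
finite set `F`. -/
def RokhlinTowers (α : CStarPartialAction G A) (d : ℕ) (F : Finset A) (ε : ℝ)
    (f : G → Fin (d + 1) → A) : Prop :=
  (∀ g j, f g j ∈ α.dom g ∧ IsPosContraction (f g j)) ∧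
  (∀ g h j, ∀ a ∈ F, ∀ x ∈ F, x ∈ α.dom g⁻¹ →
    ‖(α.act g (f h j * x) - f (g * h) j * α.act g x) * a‖ < ε) ∧
  (∀ j, ∀ g h : G, g ≠ h → ∀ a ∈ F, ‖f g j * f h j * a‖ < ε) ∧
  (∀ a ∈ F, ‖(∑ j : Fin (d + 1), ∑ g : G, f g j) * a - a‖ < ε) ∧
  (∀ g j, ∀ a ∈ F, ∀ b ∈ F, ‖(f g j * b - b * f g j) * a‖ < ε)

/-- Condition (5): approximately commuting towers. -/
def CommutingTowers (d : ℕ) (F : Finset A) (ε : ℝ) (f : G → Fin (d + 1) → A) : Prop :=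
  ∀ g h : G, ∀ j k : Fin (d + 1), ∀ a ∈ F, ‖(f g j * f h k - f h k * f g j) * a‖ < ε

/-- `α` has Rokhlin dimension at most `d`. -/
def HasRokhlinDimLE (α : CStarPartialAction G A) (d : ℕ) : Prop :=
  ∀ ε > (0 : ℝ), ∀ F : Finset A, ∃ f : G → Fin (d + 1) → A, RokhlinTowers α d F ε f

/-- `α` has Rokhlin dimension with commuting towers at most `d`. -/
def HasRokhlinDimCLE (α : CStarPartialAction G A) (d : ℕ) : Prop :=
  ∀ ε > (0 : ℝ), ∀ F : Finset A, ∃ f : G → Fin (d + 1) → A,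
    RokhlinTowers α d F ε f ∧ CommutingTowers d F ε f

/-- The Rokhlin dimension of `α`, as an extended natural number. -/
noncomputable def rokhlinDim (α : CStarPartialAction G A) : ℕ∞ :=
  sInf {n : ℕ∞ | ∃ d : ℕ, n = d ∧ HasRokhlinDimLE α d}

/-- The Rokhlin dimension with commuting towers of `α`. -/
noncomputable def rokhlinDimC (α : CStarPartialAction G A) : ℕ∞ :=
  sInf {n : ℕ∞ | ∃ d : ℕ, n = d ∧ HasRokhlinDimCLE α d}

section Stmt2

variable {G : Type*} [Group G] [Fintype G] {A : Type*} [NonUnitalCStarAlgebra A]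

/-- The restriction `α|_I` of `α` to a `G`-invariant ideal `I` has Rokhlin dimension at most
`d`: this is the definition of Rokhlin dimension for the restricted partial action on the
C*-algebra `I` (whose domains are `I ∩ α.dom g`), expressed inside `A`. -/
def HasIdealRokhlinDimLE (α : CStarPartialAction G A) (I : Set A) (d : ℕ) : Prop :=
  ∀ ε > (0 : ℝ), ∀ F : Finset A, ↑F ⊆ I →
    ∃ f : G → Fin (d + 1) → A, RokhlinTowers α d F ε f ∧ ∀ g j, f g j ∈ I

/-- Rokhlin dimension with commuting towers for the restriction `α|_I`. -/
def HasIdealRokhlinDimCLE (α : CStarPartialAction G A) (I : Set A) (d : ℕ) : Prop :=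
  ∀ ε > (0 : ℝ), ∀ F : Finset A, ↑F ⊆ I →
    ∃ f : G → Fin (d + 1) → A, (RokhlinTowers α d F ε f ∧ CommutingTowers d F ε f) ∧
      ∀ g j, f g j ∈ I

/-- The Rokhlin dimension of the restricted partial action `α|_I`. -/
noncomputable def idealRokhlinDim (α : CStarPartialAction G A) (I : Set A) : ℕ∞ :=
  sInf {n : ℕ∞ | ∃ d : ℕ, n = d ∧ HasIdealRokhlinDimLE α I d}

/-- The Rokhlin dimension with commuting towers of `α|_I`. -/
noncomputable def idealRokhlinDimC (α : CStarPartialAction G A) (I : Set A) : ℕ∞ :=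
  sInf {n : ℕ∞ | ∃ d : ℕ, n = d ∧ HasIdealRokhlinDimCLE α I d}

open Filter Topology

section PartialAction

variable {H : Type*} [Group H] {B : Type*} [NonUnitalCStarAlgebra B]

/-- The domain ideal `dom g` as a star subalgebra. -/
def CStarPartialAction.domSubalgebra (α : CStarPartialAction H B) (g : H) :
    NonUnitalStarSubalgebra ℂ B where
  carrier := α.dom g
  zero_mem' := α.zero_mem g
  add_mem' hx hy := α.add_mem g _ hx _ hy
  smul_mem' c _ hx := α.smul_mem g c _ hx
  mul_mem' _ hy := α.mul_mem_left g _ _ hy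
  star_mem' hx := α.star_mem g _ hx

/-- The map `act g`, as a star homomorphism on its domain. -/
def CStarPartialAction.actHom (α : CStarPartialAction H B) (g : H) :
    α.domSubalgebra g⁻¹ →⋆ₙₐ[ℂ] B where
  toFun x := α.act g x
  map_zero' := by simpa using α.act_smul g 0 0 (α.zero_mem _)
  map_add' x y := α.act_add g x x.2 y y.2
  map_smul' c x := α.act_smul g c x x.2
  map_mul' x y := α.act_mul g x x.2 y y.2
  map_star' x := α.act_star g x x.2

theorem CStarPartialAction.tendsto_act (α : CStarPartialAction H B) {g : H} {ι : Type*}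
    {l : Filter ι} {u : ι → B} {y : B} (hu : ∀ i, u i ∈ α.dom g⁻¹) (hy : y ∈ α.dom g⁻¹)
    (h : Tendsto u l (𝓝 y)) : Tendsto (fun i ↦ α.act g (u i)) l (𝓝 (α.act g y)) := by
  have : IsClosed (α.domSubalgebra g⁻¹ : Set B) := α.dom_isClosed g⁻¹
  have hcont : Continuous (α.actHom g) :=
    AddMonoidHomClass.continuous_of_bound (α.actHom g) 1 fun x ↦ by
      simpa using NonUnitalStarAlgHom.norm_apply_le (α.actHom g) x
  have hsub : Tendsto (fun i ↦ (⟨u i, hu i⟩ : α.domSubalgebra g⁻¹)) l (𝓝 ⟨y, hy⟩) :=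
    tendsto_subtype_rng.2 h
  exact (hcont.tendsto _).comp hsub

end PartialAction

theorem IsPosContraction.map {B C : Type*} [NonUnitalCStarAlgebra B] [NonUnitalCStarAlgebra C]
    (φ : B →⋆ₙₐ[ℂ] C) {f : B} (hf : IsPosContraction f) : IsPosContraction (φ f) := by
  obtain ⟨⟨b, rfl⟩, hb⟩ := hf
  exact ⟨⟨φ b, by rw [map_mul, map_star]⟩, (NonUnitalStarAlgHom.norm_apply_le φ _).trans hb⟩

theorem IsPosContraction.conj {B : Type*} [NonUnitalCStarAlgebra B] {e f : B}
    (hf : IsPosContraction f) (he : star e = e) (hnorm : ‖e‖ ≤ 1) :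
    IsPosContraction (e * f * e) := by
  obtain ⟨⟨b, rfl⟩, hb⟩ := hf
  refine ⟨⟨b * e, by simp [he, mul_assoc]⟩, ?_⟩
  calc ‖e * (star b * b) * e‖ ≤ ‖e‖ * ‖star b * b‖ * ‖e‖ :=
        (norm_mul_le _ _).trans (by gcongr; exact norm_mul_le _ _)
    _ ≤ 1 * 1 * 1 := by gcongr
    _ = 1 := by norm_num

/-- A filter of selfadjoint contractions of `S` acting approximately as a left unit on `S`. -/
structure IsApproximateUnitOf {B : Type*} [NonUnitalCStarAlgebra B] (l : Filter B)
    (S : Set B) : Prop where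
  neBot : l.NeBot
  eventually_mem : ∀ᶠ e in l, e ∈ S
  eventually_star : ∀ᶠ e in l, star e = e
  eventually_norm : ∀ᶠ e in l, ‖e‖ ≤ 1
  tendsto : ∀ x ∈ S, Tendsto (· * x) l (𝓝 x)

theorem exists_isApproximateUnitOf {B : Type*} [NonUnitalCStarAlgebra B]
    (S : NonUnitalStarSubalgebra ℂ B) (hS : IsClosed (S : Set B)) :
    ∃ l : Filter B, IsApproximateUnitOf l S := by
  let _ := CStarAlgebra.spectralOrder S
  let _ := CStarAlgebra.spectralOrderedRing S
  have h := CStarAlgebra.increasingApproximateUnit S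
  have := h.neBot
  refine ⟨map (↑) (CStarAlgebra.approximateUnit S), inferInstance, ?_, ?_, ?_, fun x hx ↦ ?_⟩
  · exact eventually_map.2 (.of_forall fun e ↦ e.2)
  · exact eventually_map.2 (h.eventually_star_eq.mono fun e he ↦ congrArg Subtype.val he)
  · exact eventually_map.2 h.eventually_norm
  · exact tendsto_map'_iff.2 (tendsto_subtype_rng.1 (h.tendsto_mul_right ⟨x, hx⟩))

theorem IsApproximateUnitOf.tendsto_mul {B : Type*} [NonUnitalCStarAlgebra B] {l : Filter B}
    {S : Set B} (hl : IsApproximateUnitOf l S) {u : B → B} {y : B} (hy : y ∈ S)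
    (hu : Tendsto u l (𝓝 y)) : Tendsto (fun e ↦ e * u e) l (𝓝 y) := by
  have hzero : Tendsto (fun e ↦ e * (u e - y)) l (𝓝 0) := by
    refine squeeze_zero_norm' (a := fun e ↦ ‖u e - y‖) ?_ (tendsto_iff_norm_sub_tendsto_zero.1 hu)
    filter_upwards [hl.eventually_norm] with e he
    exact (norm_mul_le _ _).trans (mul_le_of_le_one_left (norm_nonneg _) he)
  simpa [mul_sub] using hzero.add (hl.tendsto y hy)

theorem IsApproximateUnitOf.tendsto_conj_mul {B : Type*} [NonUnitalCStarAlgebra B]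
    {l : Filter B} {S : Set B} (hl : IsApproximateUnitOf l S)
    (hmul : ∀ a, ∀ x ∈ S, a * x ∈ S) (f : B) {u : B → B} {y : B} (hy : y ∈ S)
    (hu : Tendsto u l (𝓝 y)) : Tendsto (fun e ↦ e * f * e * u e) l (𝓝 (f * y)) := by
  simpa only [mul_assoc] using
    hl.tendsto_mul (hmul f y hy) ((hl.tendsto_mul hy hu).const_mul f)

theorem RokhlinTowers.eventually_conj {α : CStarPartialAction G A} {I : Set A}
    (hImull : ∀ (a : A), ∀ x ∈ I, a * x ∈ I)
    (hIinv : ∀ g : G, ∀ x ∈ I ∩ α.dom g⁻¹, α.act g x ∈ I)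
    {l : Filter A} (hl : IsApproximateUnitOf l I) {d : ℕ} {F : Finset A} (hF : ↑F ⊆ I)
    {ε : ℝ} {f : G → Fin (d + 1) → A} (hf : RokhlinTowers α d F ε f) :
    ∀ᶠ e in l, RokhlinTowers α d F ε (fun g j ↦ e * f g j * e) := by
  have hconj (g : G) (j : Fin (d + 1)) {y : A} (hy : y ∈ I) :
      Tendsto (fun e ↦ e * f g j * e * y) l (𝓝 (f g j * y)) :=
    hl.tendsto_conj_mul hImull _ hy tendsto_const_nhds
  obtain ⟨hpos, hact, horth, hsum, hcomm⟩ := hf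
  refine .and ?_ (.and ?_ (.and ?_ (.and ?_ ?_)))
  · filter_upwards [hl.eventually_star, hl.eventually_norm] with e hstar hnorm g j
    exact ⟨α.mul_mem_right g _ _ (α.mul_mem_left g _ _ (hpos g j).1),
      (hpos g j).2.conj hstar hnorm⟩
  · simp only [eventually_all, eventually_all_finset]
    intro g h j a ha x hx hxg
    have hlim := ((α.tendsto_act (fun _ ↦ α.mul_mem_left _ _ _ hxg)
      (α.mul_mem_left _ _ _ hxg) (hconj h j (hF hx))).sub
      (hconj (g * h) j (hIinv g x ⟨hF hx, hxg⟩))).mul_const a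
    exact hlim.norm.eventually_lt_const (hact g h j a ha x hx hxg)
  · simp only [eventually_all, eventually_all_finset]
    intro j g h hgh a ha
    have hlim := hl.tendsto_conj_mul hImull (f g j) (hImull (f h j) a (hF ha))
      (hconj h j (hF ha))
    simp only [← mul_assoc] at hlim
    refine hlim.norm.eventually_lt_const (horth j g h hgh a ha) |>.mono fun e he ↦ ?_
    simpa only [mul_assoc] using he
  · simp only [eventually_all_finset]
    intro a ha
    have hlim := (tendsto_finsetSum Finset.univ fun j _ ↦
      tendsto_finsetSum Finset.univ fun g _ ↦ hconj g j (hF ha)).sub_const a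
    simp only [Finset.sum_mul] at hsum ⊢
    exact hlim.norm.eventually_lt_const (hsum a ha)
  · simp only [eventually_all, eventually_all_finset]
    intro g j a ha b hb
    have hlim := (hconj g j (hImull b a (hF ha))).sub ((hconj g j (hF ha)).const_mul b)
    simp only [← mul_assoc, ← sub_mul] at hlim
    refine hlim.norm.eventually_lt_const (hcomm g j a ha b hb) |>.mono fun e he ↦ ?_
    simpa only [mul_assoc, sub_mul] using he

theorem CommutingTowers.eventually_conj {H : Type*} [Finite H] {B : Type*}
    [NonUnitalCStarAlgebra B] {I : Set B} (hImull : ∀ (a : B), ∀ x ∈ I, a * x ∈ I)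
    {l : Filter B} (hl : IsApproximateUnitOf l I) {d : ℕ} {F : Finset B} (hF : ↑F ⊆ I)
    {ε : ℝ} {f : H → Fin (d + 1) → B} (hf : CommutingTowers d F ε f) :
    ∀ᶠ e in l, CommutingTowers d F ε (fun g j ↦ e * f g j * e) := by
  simp only [CommutingTowers, eventually_all, eventually_all_finset]
  intro g h j k a ha
  have hconj (g' h' : H) (j' k' : Fin (d + 1)) :=
    hl.tendsto_conj_mul hImull (f g' j') (hImull (f h' k') a (hF ha))
      (hl.tendsto_conj_mul hImull (f h' k') (hF ha) tendsto_const_nhds)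
  have hlim := (hconj g h j k).sub (hconj h g k j)
  simp only [← mul_assoc, ← sub_mul] at hlim
  refine hlim.norm.eventually_lt_const (hf g h j k a ha) |>.mono fun e he ↦ ?_
  simpa only [mul_assoc, sub_mul] using he

theorem CommutingTowers.map {H B C : Type*} [NonUnitalCStarAlgebra B] [NonUnitalCStarAlgebra C]
    {π : B →⋆ₙₐ[ℂ] C} {F : Finset C} {F' : Finset B} (hlift : ∀ c ∈ F, ∃ a ∈ F', π a = c)
    {d : ℕ} {ε : ℝ} {f : H → Fin (d + 1) → B} (hf : CommutingTowers d F' ε f) :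
    CommutingTowers d F ε (fun g j ↦ π (f g j)) := by
  intro g h j k c hc
  obtain ⟨a, ha, rfl⟩ := hlift c hc
  simpa only [map_mul, map_sub] using
    (NonUnitalStarAlgHom.norm_apply_le π _).trans_lt (hf g h j k a ha)

section Quotient

variable {C : Type*} [NonUnitalCStarAlgebra C] {α : CStarPartialAction G A}
  {γ : CStarPartialAction G C} {π : A →⋆ₙₐ[ℂ] C}

/-- Every finite subset of the quotient has a finite set of lifts containing, for each `g`,
lifts in `dom g` of those of its elements that lie in the image of `dom g`. -/
theorem exists_finset_lift (hπsurj : Function.Surjective π)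
    (hγdom : ∀ g, γ.dom g = π '' α.dom g) (F : Finset C) :
    ∃ F' : Finset A, (∀ c ∈ F, ∃ a ∈ F', π a = c) ∧
      ∀ g, ∀ c ∈ F, c ∈ γ.dom g → ∃ a ∈ F', a ∈ α.dom g ∧ π a = c := by
  classical
  have key (g : G) (c : C) : ∃ a, π a = c ∧ (c ∈ γ.dom g → a ∈ α.dom g) := by
    by_cases hc : c ∈ γ.dom g
    · obtain ⟨a, ha, rfl⟩ := hγdom g ▸ hc
      exact ⟨a, rfl, fun _ ↦ ha⟩
    · obtain ⟨a, rfl⟩ := hπsurj c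
      exact ⟨a, rfl, fun h ↦ absurd h hc⟩
  choose lift hlift hdom using key
  have hmem (g : G) (c : C) (hc : c ∈ F) :
      lift g c ∈ (Finset.univ ×ˢ F).image fun p : G × C ↦ lift p.1 p.2 :=
    Finset.mem_image.2 ⟨(g, c), by simp [hc], rfl⟩
  exact ⟨_, fun c hc ↦ ⟨_, hmem 1 c hc, hlift 1 c⟩,
    fun g c hc hcg ↦ ⟨_, hmem g c hc, hdom g c hcg, hlift g c⟩⟩

theorem RokhlinTowers.map (hγdom : ∀ g, γ.dom g = π '' α.dom g)
    (hγact : ∀ g, ∀ x ∈ α.dom g⁻¹, π (α.act g x) = γ.act g (π x))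
    {F : Finset C} {F' : Finset A} (hlift : ∀ c ∈ F, ∃ a ∈ F', π a = c)
    (hlift_dom : ∀ g, ∀ c ∈ F, c ∈ γ.dom g → ∃ a ∈ F', a ∈ α.dom g ∧ π a = c)
    {d : ℕ} {ε : ℝ} {f : G → Fin (d + 1) → A} (hf : RokhlinTowers α d F' ε f) :
    RokhlinTowers γ d F ε (fun g j ↦ π (f g j)) := by
  obtain ⟨hpos, hact, horth, hsum, hcomm⟩ := hf
  refine ⟨fun g j ↦ ⟨?_, (hpos g j).2.map π⟩, ?_, ?_, ?_, ?_⟩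
  · rw [hγdom]
    exact Set.mem_image_of_mem _ (hpos g j).1
  · intro g h j c hc z hz hzg
    obtain ⟨a, ha, rfl⟩ := hlift c hc
    obtain ⟨x, hx, hxg, rfl⟩ := hlift_dom g⁻¹ z hz hzg
    rw [← map_mul, ← hγact g _ (α.mul_mem_left _ _ _ hxg), ← hγact g x hxg, ← map_mul,
      ← map_sub, ← map_mul]
    exact (NonUnitalStarAlgHom.norm_apply_le π _).trans_lt (hact g h j a ha x hx hxg)
  · intro j g h hgh c hc
    obtain ⟨a, ha, rfl⟩ := hlift c hc
    simpa only [map_mul] using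
      (NonUnitalStarAlgHom.norm_apply_le π _).trans_lt (horth j g h hgh a ha)
  · intro c hc
    obtain ⟨a, ha, rfl⟩ := hlift c hc
    simpa only [map_mul, map_sub, map_sum] using
      (NonUnitalStarAlgHom.norm_apply_le π _).trans_lt (hsum a ha)
  · intro g j c hc z hz
    obtain ⟨a, ha, rfl⟩ := hlift c hc
    obtain ⟨b, hb, rfl⟩ := hlift z hz
    simpa only [map_mul, map_sub] using
      (NonUnitalStarAlgHom.norm_apply_le π _).trans_lt (hcomm g j a ha b hb)

end Quotient

/-- Let `α` be a partial action of a finite group `G` on a C*-algebra `A`,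
let `I` be a `G`-invariant closed two-sided ideal of `A`, and let `γ` (a partial action on a
C*-algebra `C`) be the induced partial action of `G` on `A/I`, presented via a surjective
equivariant *-homomorphism `π : A → C` with kernel `I` and `γ.dom g = π '' (α.dom g)`.
Then `dim_Rok(α|_I) ≤ dim_Rok(α)` and `dim_Rok(ᾱ) ≤ dim_Rok(α)`, and the same estimates
hold for the commuting-tower Rokhlin dimension. -/
theorem rokhlinDim_restriction_and_quotient_le
    {C : Type*} [NonUnitalCStarAlgebra C]
    (α : CStarPartialAction G A) (I : Set A)
    (hIclosed : IsClosed I) (hI0 : (0 : A) ∈ I)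
    (hIadd : ∀ x ∈ I, ∀ y ∈ I, x + y ∈ I)
    (hIsmul : ∀ (c : ℂ), ∀ x ∈ I, c • x ∈ I)
    (hImull : ∀ (a : A), ∀ x ∈ I, a * x ∈ I)
    (hImulr : ∀ (a : A), ∀ x ∈ I, x * a ∈ I)
    (hIstar : ∀ x ∈ I, star x ∈ I)
    (hIinv : ∀ g : G, ∀ x ∈ I ∩ α.dom g⁻¹, α.act g x ∈ I)
    (γ : CStarPartialAction G C) (π : A → C)
    (hπadd : ∀ x y, π (x + y) = π x + π y)
    (hπsmul : ∀ (c : ℂ) x, π (c • x) = c • π x)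
    (hπmul : ∀ x y, π (x * y) = π x * π y)
    (hπstar : ∀ x, π (star x) = star (π x))
    (hπsurj : Function.Surjective π)
    (hπker : ∀ x, π x = 0 ↔ x ∈ I)
    (hγdom : ∀ g, γ.dom g = π '' α.dom g)
    (hγact : ∀ g, ∀ x ∈ α.dom g⁻¹, π (α.act g x) = γ.act g (π x)) :
    idealRokhlinDim α I ≤ rokhlinDim α ∧ rokhlinDim γ ≤ rokhlinDim α ∧
    idealRokhlinDimC α I ≤ rokhlinDimC α ∧ rokhlinDimC γ ≤ rokhlinDimC α := by
  let S : NonUnitalStarSubalgebra ℂ A :=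
    { carrier := I
      zero_mem' := hI0
      add_mem' := fun hx hy ↦ hIadd _ hx _ hy
      smul_mem' := fun c _ hx ↦ hIsmul c _ hx
      mul_mem' := fun _ hy ↦ hImull _ _ hy
      star_mem' := fun hx ↦ hIstar _ hx }
  obtain ⟨l, hl⟩ : ∃ l : Filter A, IsApproximateUnitOf l I := exists_isApproximateUnitOf S hIclosed
  have := hl.neBot
  have hmem (f : A) : ∀ᶠ e in l, e * f * e ∈ I :=
    hl.eventually_mem.mono fun e he ↦ hImull _ e he
  let φ : A →⋆ₙₐ[ℂ] C :=
    { toFun := π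
      map_zero' := (hπker 0).2 hI0
      map_add' := hπadd
      map_smul' := hπsmul
      map_mul' := hπmul
      map_star' := hπstar }
  refine ⟨sInf_le_sInf ?_, sInf_le_sInf ?_, sInf_le_sInf ?_, sInf_le_sInf ?_⟩ <;>
    rintro _ ⟨d, rfl, hd⟩ <;> refine ⟨d, rfl, fun ε hε F ↦ ?_⟩
  · intro hF
    obtain ⟨f, hf⟩ := hd ε hε F
    obtain ⟨e, he, hI⟩ := ((hf.eventually_conj hImull hIinv hl hF).and
      (eventually_all.2 fun g ↦ eventually_all.2 fun j ↦ hmem (f g j))).exists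
    exact ⟨_, he, hI⟩
  · obtain ⟨F', hlift, hlift_dom⟩ := exists_finset_lift (π := φ) hπsurj hγdom F
    obtain ⟨f, hf⟩ := hd ε hε F'
    exact ⟨_, hf.map (π := φ) hγdom hγact hlift hlift_dom⟩
  · intro hF
    obtain ⟨f, hf, hc⟩ := hd ε hε F
    obtain ⟨e, he, hI⟩ := (((hf.eventually_conj hImull hIinv hl hF).and
      (hc.eventually_conj hImull hl hF)).and
      (eventually_all.2 fun g ↦ eventually_all.2 fun j ↦ hmem (f g j))).exists
    exact ⟨_, he, hI⟩
  · obtain ⟨F', hlift, hlift_dom⟩ := exists_finset_lift (π := φ) hπsurj hγdom F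
    obtain ⟨f, hf, hc⟩ := hd ε hε F'
    exact ⟨_, hf.map (π := φ) hγdom hγact hlift hlift_dom, hc.map (π := φ) hlift⟩

end Stmt2
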